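/- For every η ∈ (0,1) there exists τ₀ > 0 such that for every τ ∈ (0, τ₀] there exists an integer n₀ so that the following holds. Let G be a digraph on n ≥ n₀ vertices whose out-degree sequence d⁺₁ ≤ ⋯ ≤ d⁺ₙ and in-degree sequence d⁻₁ ≤ ⋯ ≤ d⁻ₙ satisfy, for every integer i with 1 ≤ i < n/2: (i) d⁺_i ≥ i + ηn or d⁻_{n−i−⌊ηn⌋} ≥ n − i, and (ii) d⁻_i ≥ i + ηn or d⁺_{n−i−⌊ηn⌋} ≥ n − i. Then δ⁰(G) ≥ ηn and G is a robust (τ², τ)-outexpander. -/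

import Mathlib

open Finset
open scoped Classical

/-- The out-degree of a vertex in a digraph given by its edge relation. -/
noncomputable def outDeg {V : Type*} [Fintype V] (G : V → V → Prop) (x : V) : ℕ :=
  (Finset.univ.filter fun y => G x y).card

/-- The in-degree of a vertex in a digraph given by its edge relation. -/
noncomputable def inDeg {V : Type*} [Fintype V] (G : V → V → Prop) (x : V) : ℕ :=
  (Finset.univ.filter fun y => G y x).card

/-- The `ν`-robust outneighbourhood of `S`: all vertices with at least `νn`
in-neighbours in `S`. -/
noncomputable def robustOutNbhd {V : Type*} [Fintype V] (G : V → V → Prop) (ν : ℝ)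
    (S : Finset V) : Finset V :=
  Finset.univ.filter fun v => ν * (Fintype.card V : ℝ) ≤ ((S.filter fun s => G s v).card : ℝ)

/-- The `ν`-robust inneighbourhood of `S`: all vertices with at least `νn`
out-neighbours in `S`. -/
noncomputable def robustInNbhd {V : Type*} [Fintype V] (G : V → V → Prop) (ν : ℝ)
    (S : Finset V) : Finset V :=
  Finset.univ.filter fun v => ν * (Fintype.card V : ℝ) ≤ ((S.filter fun s => G v s).card : ℝ)

/-- `G` is a robust `(ν,τ)`-outexpander. -/
def RobustOutexpander {V : Type*} [Fintype V] (G : V → V → Prop) (ν τ : ℝ) : Prop :=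
  ∀ S : Finset V, τ * (Fintype.card V : ℝ) < (S.card : ℝ) →
    (S.card : ℝ) < (1 - τ) * (Fintype.card V : ℝ) →
    (S.card : ℝ) + ν * (Fintype.card V : ℝ) ≤ ((robustOutNbhd G ν S).card : ℝ)

/-- `G` is a robust `(ν,τ)`-inexpander. -/
def RobustInexpander {V : Type*} [Fintype V] (G : V → V → Prop) (ν τ : ℝ) : Prop :=
  ∀ S : Finset V, τ * (Fintype.card V : ℝ) < (S.card : ℝ) →
    (S.card : ℝ) < (1 - τ) * (Fintype.card V : ℝ) →
    (S.card : ℝ) + ν * (Fintype.card V : ℝ) ≤ ((robustInNbhd G ν S).card : ℝ)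

/-- A directed Hamilton cycle in the digraph `G`: a cyclic ordering of all the
vertices such that consecutive vertices are joined by a directed edge. -/
def HasDiHamCycle {V : Type*} [Fintype V] (G : V → V → Prop) : Prop :=
  ∃ e : ZMod (Fintype.card V) ≃ V, ∀ i, G (e i) (e (i + 1))

/-- The Chvátal-type degree condition with margin `ηn` for two vertex statistics `f`, `g`
enumerated by `ef`, `eg`. -/
def ChvatalCondition {V : Type*} [Fintype V] (η : ℝ) (f g : V → ℕ)
    (ef eg : Fin (Fintype.card V) ≃ V) : Prop :=
  ∀ i : Fin (Fintype.card V), 2 * ((i : ℕ) + 1) < Fintype.card V →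
    ((((i : ℕ) + 1 : ℕ) : ℝ) + η * (Fintype.card V : ℝ) ≤ (f (ef i) : ℝ) ∨
      ∀ j : Fin (Fintype.card V),
        (j : ℕ) + 1 = Fintype.card V - ((i : ℕ) + 1) - ⌊η * (Fintype.card V : ℝ)⌋₊ →
        (Fintype.card V : ℝ) - (((i : ℕ) + 1 : ℕ) : ℝ) ≤ (g (eg j) : ℝ))

theorem card_filter_lt_le_of_monotone {V : Type*} [Fintype V] {f : V → ℕ}
    {e : Fin (Fintype.card V) ≃ V} (hf : Monotone fun i => f (e i))
    (i : Fin (Fintype.card V)) : (univ.filter fun v => f v < f (e i)).card ≤ i := by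
  have h : (univ.filter fun v => f v < f (e i)) ⊆ (Finset.Iio i).map e.toEmbedding := by
    intro v hv
    simp only [mem_filter, mem_univ, true_and] at hv
    simp only [mem_map_equiv, Finset.mem_Iio]
    by_contra! hle
    have := hf hle
    simp only [Equiv.apply_symm_apply] at this
    omega
  simpa using card_le_card h

theorem card_le_card_filter_le_add_of_monotone {V : Type*} [Fintype V] {f : V → ℕ}
    {e : Fin (Fintype.card V) ≃ V} (hf : Monotone fun i => f (e i))
    (i : Fin (Fintype.card V)) :
    Fintype.card V ≤ (univ.filter fun v => f (e i) ≤ f v).card + i := by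
  have h := card_filter_lt_le_of_monotone hf i
  have h2 := card_filter_add_card_filter_not (s := (univ : Finset V)) (fun v => f v < f (e i))
  simp only [not_lt, card_univ] at h2
  omega

/-- In terms of level sets: few vertices have small `f`, or many vertices have large `g`. -/
theorem ChvatalCondition.card_lt_or_lt_card {V : Type*} [Fintype V] {η : ℝ} {f g : V → ℕ}
    {ef eg : Fin (Fintype.card V) ≃ V} (h : ChvatalCondition η f g ef eg)
    (hf : Monotone fun i => f (ef i)) (hg : Monotone fun i => g (eg i)) {i : ℕ} (hi : 1 ≤ i)
    (hin : 2 * i < Fintype.card V) (hη : i + ⌊η * (Fintype.card V : ℝ)⌋₊ < Fintype.card V) :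
    (univ.filter fun v => (f v : ℝ) < i + η * (Fintype.card V : ℝ)).card < i ∨
      i + ⌊η * (Fintype.card V : ℝ)⌋₊ <
        (univ.filter fun v => Fintype.card V ≤ g v + i).card := by
  obtain ⟨k, rfl⟩ : ∃ k, i = k + 1 := ⟨i - 1, by omega⟩
  rcases h ⟨k, by omega⟩ hin with h | h
  · left
    refine Nat.lt_succ_of_le (le_trans (card_le_card ?_)
      (card_filter_lt_le_of_monotone hf ⟨k, by omega⟩))
    intro v hv
    simp only [mem_filter, mem_univ, true_and] at hv ⊢
    exact_mod_cast hv.trans_le h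
  · right
    obtain ⟨j, hj⟩ : ∃ j : Fin (Fintype.card V),
        (j : ℕ) + 1 = Fintype.card V - (k + 1) - ⌊η * (Fintype.card V : ℝ)⌋₊ :=
      ⟨⟨Fintype.card V - (k + 1) - ⌊η * (Fintype.card V : ℝ)⌋₊ - 1, by omega⟩,
        by simp only; omega⟩
    have hle : (Fintype.card V : ℝ) - ((k + 1 : ℕ) : ℝ) ≤ g (eg j) := h j hj
    rw [sub_le_iff_le_add] at hle
    norm_cast at hle
    have hcard := card_le_card_filter_le_add_of_monotone hg j
    have hsub : (univ.filter fun v => g (eg j) ≤ g v) ⊆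
        univ.filter fun v => Fintype.card V ≤ g v + (k + 1) := by
      intro v hv
      simp only [mem_filter, mem_univ, true_and] at hv ⊢
      omega
    have := card_le_card hsub
    omega

theorem ChvatalCondition.card_lt_or_min_le_card {V : Type*} [Fintype V] {η : ℝ} {f g : V → ℕ}
    {ef eg : Fin (Fintype.card V) ≃ V} (h : ChvatalCondition η f g ef eg)
    (hf : Monotone fun i => f (ef i)) (hg : Monotone fun i => g (eg i))
    (hmin : ∀ v, η * (Fintype.card V : ℝ) ≤ g v) {i : ℕ} (hi : 1 ≤ i)
    (hin : 2 * i < Fintype.card V) :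
    (univ.filter fun v => (f v : ℝ) < i + η * (Fintype.card V : ℝ)).card < i ∨
      min (Fintype.card V) (i + ⌊η * (Fintype.card V : ℝ)⌋₊ + 1) ≤
        (univ.filter fun v => Fintype.card V ≤ g v + i).card := by
  rcases lt_or_ge (i + ⌊η * (Fintype.card V : ℝ)⌋₊) (Fintype.card V) with hlt | hge
  · exact (h.card_lt_or_lt_card hf hg hi hin hlt).imp_right fun h => (min_le_right _ _).trans h
  · right
    rw [filter_true_of_mem, card_univ]
    · exact min_le_left _ _
    · intro v _
      have : ⌊η * (Fintype.card V : ℝ)⌋₊ ≤ g v := Nat.floor_le_of_le (hmin v)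
      omega

/-- The condition at the index `1` forces large minimum out-degree. -/
theorem ChvatalCondition.le_outDeg {V : Type*} [Fintype V] {G : V → V → Prop}
    (hG : ∀ v, ¬ G v v) {η : ℝ} {ep em : Fin (Fintype.card V) ≃ V}
    (h : ChvatalCondition η (outDeg G) (inDeg G) ep em)
    (hp : Monotone fun i => outDeg G (ep i)) (hm : Monotone fun i => inDeg G (em i))
    (hn : 2 < Fintype.card V) (hη : 1 + ⌊η * (Fintype.card V : ℝ)⌋₊ < Fintype.card V) (v : V) :
    η * (Fintype.card V : ℝ) ≤ outDeg G v := by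
  rcases h.card_lt_or_lt_card hp hm le_rfl (by omega) hη with h | h
  · have hv : v ∉ univ.filter fun v => (outDeg G v : ℝ) < (1 : ℕ) + η * (Fintype.card V : ℝ) := by
      rw [card_eq_zero.mp (Nat.lt_one_iff.mp h)]
      simp
    simp only [mem_filter, mem_univ, true_and, not_lt, Nat.cast_one] at hv
    linarith
  · have hsub : (univ.filter fun w => Fintype.card V ≤ inDeg G w + 1) ⊆
        insert v (univ.filter fun w => G v w) := by
      intro w hw
      simp only [mem_filter, mem_univ, true_and, mem_insert] at hw ⊢
      by_contra! hne
      have : (univ.filter fun x => G x w) ⊆ (univ.erase w).erase v := by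
        intro x hx
        simp only [mem_filter, mem_univ, true_and, mem_erase, and_true] at hx ⊢
        exact ⟨by rintro rfl; exact hne.2 hx, by rintro rfl; exact hG _ hx⟩
      have := card_le_card this
      rw [card_erase_of_mem (by simpa using hne.1.symm), card_erase_of_mem (mem_univ _),
        card_univ] at this
      unfold inDeg at hw
      omega
    have h1 := (card_le_card hsub).trans (card_insert_le _ _)
    have h2 : ⌊η * (Fintype.card V : ℝ)⌋₊ + 1 ≤ outDeg G v := by
      unfold outDeg
      omega
    have h3 : ((⌊η * (Fintype.card V : ℝ)⌋₊ + 1 : ℕ) : ℝ) ≤ outDeg G v := by exact_mod_cast h2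
    push_cast at h3
    linarith [Nat.lt_floor_add_one (η * (Fintype.card V : ℝ))]

/-- Double counting of the edges leaving a subset `A` of `S`. -/
theorem card_mul_le_card_mul_robustOutNbhd {V : Type*} [Fintype V] {G : V → V → Prop} {ν d : ℝ}
    (hν : 0 ≤ ν) {A S : Finset V} (hAS : A ⊆ S) (hd : ∀ v ∈ A, d ≤ outDeg G v) :
    (A.card : ℝ) * d ≤ A.card * (robustOutNbhd G ν S).card +
      ν * (Fintype.card V : ℝ) * Fintype.card V := by
  have hswap : ∑ a ∈ A, outDeg G a = ∑ v, (A.filter fun a => G a v).card :=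
    sum_card_bipartiteAbove_eq_sum_card_bipartiteBelow G
  have hbound : ∀ v : V, ((A.filter fun a => G a v).card : ℝ) ≤
      (if v ∈ robustOutNbhd G ν S then (A.card : ℝ) else 0) + ν * Fintype.card V := by
    intro v
    split_ifs with hv
    · have : ((A.filter fun a => G a v).card : ℝ) ≤ A.card := by
        exact_mod_cast card_filter_le _ _
      have : 0 ≤ ν * (Fintype.card V : ℝ) := by positivity
      linarith
    · simp only [robustOutNbhd, mem_filter, mem_univ, true_and, not_le] at hv
      have : ((A.filter fun a => G a v).card : ℝ) ≤ (S.filter fun a => G a v).card := by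
        exact_mod_cast card_le_card (filter_subset_filter _ hAS)
      linarith
  calc (A.card : ℝ) * d = ∑ _a ∈ A, d := by simp
    _ ≤ ∑ a ∈ A, (outDeg G a : ℝ) := sum_le_sum hd
    _ = ∑ v, ((A.filter fun a => G a v).card : ℝ) := by exact_mod_cast hswap
    _ ≤ ∑ v, ((if v ∈ robustOutNbhd G ν S then (A.card : ℝ) else 0) + ν * Fintype.card V) :=
      sum_le_sum fun v _ => hbound v
    _ = _ := by
      simp [sum_add_distrib]
      ring

theorem inDeg_add_card_le {V : Type*} [Fintype V] (G : V → V → Prop) (S : Finset V) (v : V) :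
    inDeg G v + S.card ≤ (S.filter fun s => G s v).card + Fintype.card V := by
  have h1 : (univ.filter fun s => G s v) ⊆ (S.filter fun s => G s v) ∪ Sᶜ := by
    intro x hx
    simp only [mem_filter, mem_univ, true_and, mem_union, mem_compl] at hx ⊢
    tauto
  have h2 := (card_le_card h1).trans (card_union_le _ _)
  have h3 := card_add_card_compl S
  unfold inDeg
  omega

/-- Expansion of the sets with at most half of the vertices. -/
theorem ChvatalCondition.expands_of_two_mul_card_le {V : Type*} [Fintype V] {G : V → V → Prop}
    {η τ : ℝ} {ep em : Fin (Fintype.card V) ≃ V}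
    (h : ChvatalCondition η (outDeg G) (inDeg G) ep em)
    (hp : Monotone fun i => outDeg G (ep i)) (hm : Monotone fun i => inDeg G (em i))
    (hmin : ∀ v, η * (Fintype.card V : ℝ) ≤ inDeg G v)
    (hτ : 0 < τ) (hτη : 20 * τ ≤ η) (hη : η < 1) (hn : 20 ≤ τ * (Fintype.card V : ℝ))
    {S : Finset V} (hS : τ * (Fintype.card V : ℝ) < S.card)
    (hS2 : 2 * S.card ≤ Fintype.card V) :
    (S.card : ℝ) + τ ^ 2 * (Fintype.card V : ℝ) ≤ (robustOutNbhd G (τ ^ 2) S).card := by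
  set n := Fintype.card V with hndef
  have hn0 : (0 : ℝ) ≤ n := Nat.cast_nonneg _
  set m := ⌊τ * (n : ℝ) / 2⌋₊
  have hm1 : (m : ℝ) ≤ τ * n / 2 := Nat.floor_le (by positivity)
  have hm2 : τ * n / 2 < m + 1 := Nat.lt_floor_add_one _
  have hν : τ ^ 2 * (n : ℝ) ≤ τ * n / 20 := by nlinarith [mul_nonneg hτ.le hn0]
  have hτn : 20 * (τ * n) ≤ η * (n : ℝ) := by nlinarith
  have hηn : η * (n : ℝ) ≤ n := by nlinarith
  have hmS : m < S.card := by
    have : (m : ℝ) < S.card := by linarith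
    exact_mod_cast this
  have hmpos : 0 < m := by
    have : (0 : ℝ) < m := by linarith
    exact_mod_cast this
  have hS2' : 2 * (S.card : ℝ) ≤ n := by exact_mod_cast hS2
  obtain ⟨i, hi⟩ : ∃ i, S.card = i + m := ⟨S.card - m, by omega⟩
  have hi' : (S.card : ℝ) = i + m := by exact_mod_cast hi
  rcases h.card_lt_or_min_le_card hp hm hmin (i := i) (by omega) (by omega) with h | h
  · set A := S.filter fun v => (i : ℝ) + η * n ≤ outDeg G v with hA
    have hAS : A ⊆ S := filter_subset _ _
    have hAcard : m + 1 ≤ A.card := by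
      have h1 := card_sdiff_add_card_eq_card hAS
      have h2 : (S \ A).card < i := by
        refine lt_of_le_of_lt (card_le_card ?_) h
        intro v hv
        simp only [hA, mem_sdiff, mem_filter, mem_univ, true_and, not_and, not_le] at hv ⊢
        exact hv.2 hv.1
      omega
    have hAcard' : (m : ℝ) + 1 ≤ A.card := by exact_mod_cast hAcard
    have hcount := card_mul_le_card_mul_robustOutNbhd (G := G) (ν := τ ^ 2) (sq_nonneg τ)
      hAS (d := (i : ℝ) + η * n) (fun v hv => (mem_filter.mp hv).2)
    by_contra! hlt
    have h1 : (A.card : ℝ) * (2 * (τ * n)) ≤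
        A.card * ((i : ℝ) + η * n - (robustOutNbhd G (τ ^ 2) S).card) := by
      gcongr
      linarith
    have h2 : τ * n / 2 * (2 * (τ * n)) < (A.card : ℝ) * (2 * (τ * n)) := by
      apply mul_lt_mul_of_pos_right <;> linarith
    rw [← hndef] at hcount
    linarith
  · have hsub : (univ.filter fun v => n ≤ inDeg G v + i) ⊆ robustOutNbhd G (τ ^ 2) S := by
      intro v hv
      simp only [robustOutNbhd, mem_filter, mem_univ, true_and] at hv ⊢
      have h1 := inDeg_add_card_le G S v
      have h2 : m ≤ (S.filter fun s => G s v).card := by omega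
      have h3 : (m : ℝ) ≤ (S.filter fun s => G s v).card := by exact_mod_cast h2
      linarith
    have h1 := h.trans (card_le_card hsub)
    rcases min_le_iff.mp h1 with h1 | h1
    · have h2 : (n : ℝ) ≤ (robustOutNbhd G (τ ^ 2) S).card := by exact_mod_cast h1
      linarith
    · have h2 : (i : ℝ) + ⌊η * (n : ℝ)⌋₊ + 1 ≤ (robustOutNbhd G (τ ^ 2) S).card := by
        exact_mod_cast h1
      linarith [Nat.lt_floor_add_one (η * (n : ℝ))]

/-- Expansion of the sets with at least half of the vertices. -/
theorem ChvatalCondition.expands_of_le_two_mul_card {V : Type*} [Fintype V] {G : V → V → Prop}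
    {η τ : ℝ} {ep em : Fin (Fintype.card V) ≃ V}
    (h : ChvatalCondition η (inDeg G) (outDeg G) em ep)
    (hp : Monotone fun i => outDeg G (ep i)) (hm : Monotone fun i => inDeg G (em i))
    (hmin : ∀ v, η * (Fintype.card V : ℝ) ≤ outDeg G v)
    (hτ : 0 < τ) (hτη : 20 * τ ≤ η) (hη : η < 1) (hn : 20 ≤ τ * (Fintype.card V : ℝ))
    {S : Finset V} (hS : (S.card : ℝ) < (1 - τ) * (Fintype.card V : ℝ))
    (hS2 : Fintype.card V ≤ 2 * S.card) :
    (S.card : ℝ) + τ ^ 2 * (Fintype.card V : ℝ) ≤ (robustOutNbhd G (τ ^ 2) S).card := by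
  set n := Fintype.card V with hndef
  have hn0 : (0 : ℝ) ≤ n := Nat.cast_nonneg _
  set m := ⌊τ * (n : ℝ) / 2⌋₊
  have hm1 : (m : ℝ) ≤ τ * n / 2 := Nat.floor_le (by positivity)
  have hm2 : τ * n / 2 < m + 1 := Nat.lt_floor_add_one _
  have hν : τ ^ 2 * (n : ℝ) ≤ τ * n / 20 := by nlinarith [mul_nonneg hτ.le hn0]
  have hτn : 20 * (τ * n) ≤ η * (n : ℝ) := by nlinarith
  have hηn : η * (n : ℝ) ≤ n := by nlinarith
  have hmS : S.card + m < n := by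
    have : (S.card : ℝ) + m < n := by linarith
    exact_mod_cast this
  have hmpos : 0 < m := by
    have : (0 : ℝ) < m := by linarith
    exact_mod_cast this
  have hS2' : (n : ℝ) ≤ 2 * S.card := by exact_mod_cast hS2
  obtain ⟨i, hi⟩ : ∃ i, n = S.card + m + i := ⟨n - (S.card + m), by omega⟩
  have hi' : (n : ℝ) = S.card + m + i := by exact_mod_cast hi
  by_contra! hlt
  rcases h.card_lt_or_min_le_card hm hp hmin (i := i) (by omega) (by omega) with h | h
  · have hsub : (robustOutNbhd G (τ ^ 2) S)ᶜ ⊆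
        univ.filter fun v => (inDeg G v : ℝ) < i + η * n := by
      intro v hv
      simp only [robustOutNbhd, mem_compl, mem_filter, mem_univ, true_and, not_le] at hv ⊢
      have h1 : (inDeg G v : ℝ) + S.card ≤ (S.filter fun s => G s v).card + n := by
        exact_mod_cast inDeg_add_card_le G S v
      linarith
    have h1 := (card_le_card hsub).trans_lt h
    have h2 := card_add_card_compl (robustOutNbhd G (τ ^ 2) S)
    have h3 : S.card + m < (robustOutNbhd G (τ ^ 2) S).card := by omega
    have h4 : (S.card : ℝ) + m < (robustOutNbhd G (τ ^ 2) S).card := by exact_mod_cast h3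
    linarith
  · set B := univ.filter fun v => n ≤ outDeg G v + i
    have hAcard : η * n / 2 ≤ ((S ∩ B).card : ℝ) := by
      have h1 : S.card + B.card ≤ (S ∩ B).card + n := by
        rw [← card_union_add_card_inter, add_comm]
        exact Nat.add_le_add_left (card_le_univ _) _
      have h1' : (S.card : ℝ) + B.card ≤ (S ∩ B).card + n := by exact_mod_cast h1
      rcases min_le_iff.mp h with h2 | h2
      · have h2' : (n : ℝ) ≤ B.card := by exact_mod_cast h2
        linarith
      · have h2' : (i : ℝ) + ⌊η * (n : ℝ)⌋₊ + 1 ≤ B.card := by exact_mod_cast h2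
        linarith [Nat.lt_floor_add_one (η * (n : ℝ))]
    have hcount := card_mul_le_card_mul_robustOutNbhd (G := G) (ν := τ ^ 2) (sq_nonneg τ)
      (inter_subset_left : S ∩ B ⊆ S) (d := (n : ℝ) - i) (fun v hv => by
        have h1 : n ≤ outDeg G v + i := (mem_filter.mp (mem_inter.mp hv).2).2
        have h2 : (n : ℝ) ≤ outDeg G v + i := by exact_mod_cast h1
        linarith)
    have h1 : ((S ∩ B).card : ℝ) * (τ * n / 5) ≤
        (S ∩ B).card * ((n : ℝ) - i - (robustOutNbhd G (τ ^ 2) S).card) :=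
      mul_le_mul_of_nonneg_left (by linarith) (Nat.cast_nonneg _)
    have h2 : 10 * (τ * n) * (τ * n / 5) ≤ ((S ∩ B).card : ℝ) * (τ * n / 5) :=
      mul_le_mul_of_nonneg_right (by linarith) (by linarith)
    have h3 : 0 < (τ * n) * (τ * n) := by
      have : 0 < τ * (n : ℝ) := by linarith
      positivity
    rw [← hndef] at hcount
    linarith

/-- A digraph whose out- and in-degree sequences satisfy the given
Chvátal-type conditions with margin `ηn` has minimum semidegree at least `ηn`
and is a robust `(τ², τ)`-outexpander. Here `ep` (resp. `em`) is an enumeration of the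
vertices with non-decreasing out-degrees (resp. in-degrees), so that the `1`-indexed
out-degree sequence is `d⁺_{i+1} = outDeg G (ep i)` for `i : Fin n`. -/
theorem degree_sequence_robust_outexpander (η : ℝ) (hη0 : 0 < η) (hη1 : η < 1) :
    ∃ τ₀ : ℝ, 0 < τ₀ ∧ ∀ τ : ℝ, 0 < τ → τ ≤ τ₀ →
    ∃ n₀ : ℕ, ∀ (V : Type) [Fintype V] (G : V → V → Prop),
      (∀ v : V, ¬ G v v) →
      n₀ ≤ Fintype.card V →
      ∀ (ep : Fin (Fintype.card V) ≃ V) (em : Fin (Fintype.card V) ≃ V),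
      Monotone (fun i : Fin (Fintype.card V) => outDeg G (ep i)) →
      Monotone (fun i : Fin (Fintype.card V) => inDeg G (em i)) →
      -- (i)  d⁺_i ≥ i + ηn  or  d⁻_{n−i−⌊ηn⌋} ≥ n − i,  for all 1 ≤ i < n/2
      (∀ i : Fin (Fintype.card V), 2 * ((i : ℕ) + 1) < Fintype.card V →
        ((((i : ℕ) + 1 : ℕ) : ℝ) + η * (Fintype.card V : ℝ) ≤ (outDeg G (ep i) : ℝ) ∨
          ∀ j : Fin (Fintype.card V),
            (j : ℕ) + 1 = Fintype.card V - ((i : ℕ) + 1) - ⌊η * (Fintype.card V : ℝ)⌋₊ →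
            (Fintype.card V : ℝ) - (((i : ℕ) + 1 : ℕ) : ℝ) ≤ (inDeg G (em j) : ℝ))) →
      -- (ii) d⁻_i ≥ i + ηn  or  d⁺_{n−i−⌊ηn⌋} ≥ n − i,  for all 1 ≤ i < n/2
      (∀ i : Fin (Fintype.card V), 2 * ((i : ℕ) + 1) < Fintype.card V →
        ((((i : ℕ) + 1 : ℕ) : ℝ) + η * (Fintype.card V : ℝ) ≤ (inDeg G (em i) : ℝ) ∨
          ∀ j : Fin (Fintype.card V),
            (j : ℕ) + 1 = Fintype.card V - ((i : ℕ) + 1) - ⌊η * (Fintype.card V : ℝ)⌋₊ →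
            (Fintype.card V : ℝ) - (((i : ℕ) + 1 : ℕ) : ℝ) ≤ (outDeg G (ep j) : ℝ))) →
      ((∀ v : V, η * (Fintype.card V : ℝ) ≤ (outDeg G v : ℝ) ∧
          η * (Fintype.card V : ℝ) ≤ (inDeg G v : ℝ)) ∧
        RobustOutexpander G (τ ^ 2) τ) := by
  refine ⟨η / 20, by positivity, fun τ hτ hτ₀ => ?_⟩
  refine ⟨⌈20 / τ⌉₊ + ⌈2 / (1 - η)⌉₊ + 3, ?_⟩
  intro V _ G hG hn ep em hp hm h1 h2
  have hn' : ((⌈20 / τ⌉₊ + ⌈2 / (1 - η)⌉₊ + 3 : ℕ) : ℝ) ≤ Fintype.card V := by exact_mod_cast hn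
  push_cast at hn'
  have hτn : 20 ≤ τ * (Fintype.card V : ℝ) := by
    rw [← div_le_iff₀' hτ]
    linarith [Nat.le_ceil (20 / τ), (Nat.cast_nonneg _ : (0 : ℝ) ≤ ⌈2 / (1 - η)⌉₊)]
  have hηn : 2 ≤ (1 - η) * (Fintype.card V : ℝ) := by
    rw [← div_le_iff₀' (by linarith)]
    linarith [Nat.le_ceil (2 / (1 - η)), (Nat.cast_nonneg _ : (0 : ℝ) ≤ ⌈20 / τ⌉₊)]
  have hfloor : 1 + ⌊η * (Fintype.card V : ℝ)⌋₊ < Fintype.card V := by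
    have := Nat.floor_le (show 0 ≤ η * (Fintype.card V : ℝ) by positivity)
    have : 1 + (⌊η * (Fintype.card V : ℝ)⌋₊ : ℝ) < Fintype.card V := by linarith
    exact_mod_cast this
  replace h1 : ChvatalCondition η (outDeg G) (inDeg G) ep em := h1
  replace h2 : ChvatalCondition η (inDeg G) (outDeg G) em ep := h2
  have hout := h1.le_outDeg hG hp hm (by omega) hfloor
  have hin : ∀ v, η * (Fintype.card V : ℝ) ≤ inDeg G v :=
    ChvatalCondition.le_outDeg (G := fun x y => G y x) hG h2 hm hp (by omega) hfloor
  refine ⟨fun v => ⟨hout v, hin v⟩, fun S hS hS' => ?_⟩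
  rcases le_total (2 * S.card) (Fintype.card V) with hle | hle
  · exact h1.expands_of_two_mul_card_le hp hm hin hτ (by linarith) hη1 hτn hS hle
  · exact h2.expands_of_le_two_mul_card hp hm hout hτ (by linarith) hη1 hτn hS' hle
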